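/- arXiv:2212.05440 — 3 statements merged into one kernel-verified Lean document; each statement's English description precedes it below -/
import Mathlib

section
/- As x → ∞ one has ∑_{abc ≤ x} Ω(gcd(a,b,c)) = (C₂/2)·x·(log x)² + O(x·log x), where the sum is over all triples (a,b,c) of positive integers with abc ≤ x and C₂ = ∑_p 1/(p³ - 1), the sum being over all primes p. -/
open Finset Filter Real ArithmeticFunction

/-- The set of triples of positive integers whose product is at most `N`. -/
noncomputable def triplesLe (N : ℕ) : Finset (ℕ × ℕ × ℕ) :=
  ((Finset.Icc 1 N) ×ˢ (Finset.Icc 1 N) ×ˢ (Finset.Icc 1 N)).filter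
    fun t => t.1 * t.2.1 * t.2.2 ≤ N

/-- The number of prime divisors counted with multiplicity is the number of divisors that are
prime powers. -/
theorem card_divisors_filter_isPrimePow {n : ℕ} (hn : n ≠ 0) :
    #{d ∈ n.divisors | IsPrimePow d} = cardFactors n := by
  induction n using Nat.recOnPosPrimePosCoprime with
  | zero => exact absurd rfl hn
  | one => simp [Finset.filter_singleton, not_isPrimePow_one]
  | prime_pow p k hp hk =>
    rw [cardFactors_apply_prime_pow hp]
    have : {d ∈ (p ^ k).divisors | IsPrimePow d}
        = (Finset.Icc 1 k).image (p ^ ·) := by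
      ext d
      simp only [mem_filter, Nat.mem_divisors_prime_pow hp, mem_image, mem_Icc]
      constructor
      · rintro ⟨⟨j, hj, rfl⟩, h⟩
        refine ⟨j, ⟨?_, hj⟩, rfl⟩
        rcases Nat.eq_zero_or_pos j with rfl | hj0
        · exact absurd h (by simpa using not_isPrimePow_one)
        · exact hj0
      · rintro ⟨j, ⟨h1, h2⟩, rfl⟩
        exact ⟨⟨j, h2, rfl⟩, hp.isPrimePow.pow (by omega)⟩
    rw [this, card_image_of_injective _ (Nat.pow_right_injective hp.two_le)]
    simp
  | coprime a b ha hb hab iha ihb =>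
    rw [Nat.mul_divisors_filter_prime_pow hab, filter_union,
      card_union_of_disjoint (Nat.disjoint_divisors_filter_isPrimePow hab),
      iha (by omega), ihb (by omega), cardFactors_mul (by omega) (by omega)]

theorem card_triplesLe (N : ℕ) :
    #(triplesLe N) = ∑ a ∈ Icc 1 N, ∑ b ∈ Icc 1 (N / a), N / a / b := by
  rw [triplesLe, card_filter, sum_product]
  refine sum_congr rfl fun a ha => ?_
  rw [mem_Icc] at ha
  rw [sum_product]
  have hcount : ∀ b ∈ Icc 1 N,
      (∑ c ∈ Icc 1 N, if a * b * c ≤ N then 1 else 0) = N / a / b := by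
    intro b hb
    rw [mem_Icc] at hb
    rw [← card_filter, Nat.div_div_eq_div_mul]
    have hab : 0 < a * b := Nat.mul_pos ha.1 hb.1
    have : {c ∈ Icc 1 N | a * b * c ≤ N} = Icc 1 (N / (a * b)) := by
      ext c
      simp only [mem_filter, mem_Icc, Nat.le_div_iff_mul_le hab, mul_comm c]
      exact ⟨fun h => ⟨h.1.1, h.2⟩,
        fun h => ⟨⟨h.1, (Nat.le_mul_of_pos_left c hab).trans h.2⟩, h.2⟩⟩
    rw [this, Nat.card_Icc, Nat.add_sub_cancel]
  rw [sum_congr rfl hcount]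
  symm
  refine sum_subset (Icc_subset_Icc_right (Nat.div_le_self N a)) fun b hb hb' => ?_
  rw [mem_Icc] at hb hb'
  exact Nat.div_eq_of_lt (by omega)

theorem card_triplesLe_filter_dvd {q : ℕ} (hq : 0 < q) (N : ℕ) :
    #{t ∈ triplesLe N | q ∣ Nat.gcd t.1 (Nat.gcd t.2.1 t.2.2)} = #(triplesLe (N / q ^ 3)) := by
  have hq3 : 0 < q ^ 3 := by positivity
  symm
  refine card_bij (fun t _ => (q * t.1, q * t.2.1, q * t.2.2)) ?_ ?_ ?_
  · rintro ⟨a, b, c⟩ h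
    simp only [triplesLe, mem_filter, mem_product, mem_Icc, Nat.dvd_gcd_iff] at h ⊢
    obtain ⟨⟨⟨ha, -⟩, ⟨hb, -⟩, ⟨hc, -⟩⟩, h⟩ := h
    have h' : q * a * (q * b) * (q * c) ≤ N := by
      rw [Nat.le_div_iff_mul_le hq3] at h
      exact le_of_eq_of_le (by ring) h
    have hqa : 0 < q * a := Nat.mul_pos hq ha
    have hqb : 0 < q * b := Nat.mul_pos hq hb
    have hqc : 0 < q * c := Nat.mul_pos hq hc
    refine ⟨⟨⟨⟨hqa, ?_⟩, ⟨hqb, ?_⟩, ⟨hqc, ?_⟩⟩, h'⟩, by simp⟩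
    · exact ((Nat.le_mul_of_pos_right _ hqb).trans (Nat.le_mul_of_pos_right _ hqc)).trans h'
    · exact ((Nat.le_mul_of_pos_left _ hqa).trans (Nat.le_mul_of_pos_right _ hqc)).trans h'
    · exact (Nat.le_mul_of_pos_left _ (Nat.mul_pos hqa hqb)).trans h'
  · rintro ⟨a, b, c⟩ - ⟨a', b', c'⟩ - h
    simpa [hq.ne'] using h
  · rintro ⟨a, b, c⟩ h
    simp only [triplesLe, mem_filter, mem_product, mem_Icc, Nat.dvd_gcd_iff] at h
    obtain ⟨⟨⟨⟨ha, -⟩, ⟨hb, -⟩, ⟨hc, -⟩⟩, h⟩, ⟨a, rfl⟩, ⟨b, rfl⟩, ⟨c, rfl⟩⟩ := h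
    have ha' : 0 < a := Nat.pos_of_mul_pos_left ha
    have hb' : 0 < b := Nat.pos_of_mul_pos_left hb
    have hc' : 0 < c := Nat.pos_of_mul_pos_left hc
    have h' : a * b * c ≤ N / q ^ 3 := by
      rw [Nat.le_div_iff_mul_le hq3]
      exact le_of_eq_of_le (by ring) h
    refine ⟨(a, b, c), ?_, rfl⟩
    simp only [triplesLe, mem_filter, mem_product, mem_Icc]
    refine ⟨⟨⟨ha', ?_⟩, ⟨hb', ?_⟩, ⟨hc', ?_⟩⟩, h'⟩
    · exact ((Nat.le_mul_of_pos_right _ hb').trans (Nat.le_mul_of_pos_right _ hc')).trans h'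
    · exact ((Nat.le_mul_of_pos_left _ ha').trans (Nat.le_mul_of_pos_right _ hc')).trans h'
    · exact (Nat.le_mul_of_pos_left _ (Nat.mul_pos ha' hb')).trans h'

theorem sum_cardFactors_gcd_triplesLe (N : ℕ) :
    ∑ t ∈ triplesLe N, cardFactors (Nat.gcd t.1 (Nat.gcd t.2.1 t.2.2))
      = ∑ q ∈ Icc 1 N with IsPrimePow q, #(triplesLe (N / q ^ 3)) := by
  have hΩ : ∀ t ∈ triplesLe N, cardFactors (Nat.gcd t.1 (Nat.gcd t.2.1 t.2.2))
      = ∑ q ∈ Icc 1 N with IsPrimePow q,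
        if q ∣ Nat.gcd t.1 (Nat.gcd t.2.1 t.2.2) then 1 else 0 := by
    rintro ⟨a, b, c⟩ ht
    simp only [triplesLe, mem_filter, mem_product, mem_Icc] at ht
    obtain ⟨⟨⟨ha, haN⟩, -⟩, -⟩ := ht
    have hg : Nat.gcd a (Nat.gcd b c) ≠ 0 := (Nat.gcd_pos_of_pos_left _ ha).ne'
    rw [← card_divisors_filter_isPrimePow hg, ← card_filter]
    congr 1
    ext q
    simp only [mem_filter, Nat.mem_divisors, mem_Icc]
    constructor
    · rintro ⟨⟨hd, -⟩, hq⟩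
      exact ⟨⟨⟨hq.pos, (Nat.le_of_dvd ha (hd.trans (Nat.gcd_dvd_left _ _))).trans haN⟩, hq⟩, hd⟩
    · rintro ⟨⟨-, hq⟩, hd⟩
      exact ⟨⟨hd, hg⟩, hq⟩
  rw [sum_congr rfl hΩ, sum_comm]
  refine sum_congr rfl fun q hq => ?_
  rw [← card_filter, card_triplesLe_filter_dvd (mem_filter.1 hq).2.pos]

theorem harmonic_eq_sum_one_div (n : ℕ) : (harmonic n : ℝ) = ∑ i ∈ Icc 1 n, 1 / (i : ℝ) := by
  simp [harmonic_eq_sum_Icc]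

/-- The trivial form of the Dirichlet divisor problem. -/
theorem abs_sum_floor_div_sub_mul_log_le {z : ℝ} (hz : 1 ≤ z) :
    |((∑ b ∈ Icc 1 ⌊z⌋₊, ⌊z⌋₊ / b : ℕ) : ℝ) - z * log z| ≤ z := by
  have hz0 : 0 ≤ z := by linarith
  have hlow := log_le_harmonic_floor z hz0
  have hupp := harmonic_floor_le_one_add_log z hz
  rw [harmonic_eq_sum_one_div] at hlow hupp
  have hmul : z * ∑ b ∈ Icc 1 ⌊z⌋₊, 1 / (b : ℝ) = ∑ b ∈ Icc 1 ⌊z⌋₊, z / b := by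
    rw [mul_sum]; exact sum_congr rfl fun b _ => by ring
  have h1 : ((∑ b ∈ Icc 1 ⌊z⌋₊, ⌊z⌋₊ / b : ℕ) : ℝ) ≤ ∑ b ∈ Icc 1 ⌊z⌋₊, z / b := by
    push_cast
    refine sum_le_sum fun b _ => ?_
    rw [← Nat.floor_div_natCast]
    exact Nat.floor_le (by positivity)
  have h2 : ∑ b ∈ Icc 1 ⌊z⌋₊, z / b ≤ ((∑ b ∈ Icc 1 ⌊z⌋₊, ⌊z⌋₊ / b : ℕ) : ℝ) + z := by
    have : ∑ b ∈ Icc 1 ⌊z⌋₊, z / (b : ℝ) ≤ ∑ b ∈ Icc 1 ⌊z⌋₊, (((⌊z⌋₊ / b : ℕ) : ℝ) + 1) := by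
      refine sum_le_sum fun b _ => ?_
      rw [← Nat.floor_div_natCast]
      exact (Nat.lt_floor_add_one _).le
    rw [sum_add_distrib] at this
    push_cast
    have hf := Nat.floor_le hz0
    simp only [sum_const, Nat.card_Icc, Nat.add_sub_cancel, nsmul_eq_mul, mul_one] at this
    linarith
  have h3 := mul_le_mul_of_nonneg_left hlow hz0
  have h4 := mul_le_mul_of_nonneg_left hupp hz0
  rw [hmul] at h3 h4
  rw [abs_le]
  constructor <;> linarith

theorem sum_one_div_mul_log_div_bounds {y : ℝ} {n : ℕ} (hn : 1 ≤ n) (hny : (n : ℝ) ≤ y) :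
    (log y ^ 2 - log (y / n) ^ 2) / 2 + log (y / n) / n
        ≤ ∑ a ∈ Icc 1 n, 1 / (a : ℝ) * log (y / a) ∧
      ∑ a ∈ Icc 1 n, 1 / (a : ℝ) * log (y / a)
        ≤ log y + (log y ^ 2 - log (y / n) ^ 2) / 2 := by
  induction n, hn using Nat.le_induction with
  | base => simp
  | succ n hn ih =>
    push_cast at hny
    have hn0 : (0 : ℝ) < n := by exact_mod_cast hn
    have hy : 0 < y := by linarith
    obtain ⟨ih1, ih2⟩ := ih (by linarith)
    rw [sum_Icc_succ_top (by omega)]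
    push_cast
    have hv : 0 ≤ log (y / (n + 1)) := log_nonneg (by rw [le_div_iff₀ (by positivity)]; linarith)
    have hdiff : log (y / n) - log (y / (n + 1)) = Real.log ((n + 1) / n) := by
      rw [← log_div (by positivity) (by positivity)]
      congr 1
      field_simp
    have hup : log (((n : ℝ) + 1) / n) ≤ 1 / n := by
      have := log_le_sub_one_of_pos (x := ((n : ℝ) + 1) / n) (by positivity)
      have h : ((n : ℝ) + 1) / n - 1 = 1 / n := by field_simp; ring
      linarith
    have hlo : 1 / ((n : ℝ) + 1) ≤ log (((n : ℝ) + 1) / n) := by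
      have := one_sub_inv_le_log_of_pos (x := ((n : ℝ) + 1) / n) (by positivity)
      have h : 1 - (((n : ℝ) + 1) / n)⁻¹ = 1 / (n + 1) := by field_simp; ring
      linarith
    have hinv : 0 < 1 / ((n : ℝ) + 1) := by positivity
    rw [← hdiff] at hup hlo
    rw [div_eq_mul_one_div (log (y / n)) (n : ℝ)] at ih1
    rw [div_eq_mul_one_div (log (y / (n + 1))) ((n : ℝ) + 1)]
    set u := log (y / n)
    set v := log (y / (n + 1))
    have huv : v ≤ u := by linarith
    constructor
    · nlinarith [mul_nonneg (sub_nonneg.2 hup) (by linarith : 0 ≤ u + v),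
        mul_nonneg (by linarith : 0 ≤ 1 / (n : ℝ)) (sub_nonneg.2 huv)]
    · nlinarith [mul_nonneg (sub_nonneg.2 hlo) (by linarith : 0 ≤ u + v),
        mul_nonneg hinv.le (sub_nonneg.2 huv)]

theorem abs_sum_one_div_mul_log_div_sub_le {y : ℝ} (hy : 1 ≤ y) :
    |∑ a ∈ Icc 1 ⌊y⌋₊, 1 / (a : ℝ) * log (y / a) - log y ^ 2 / 2| ≤ 1 + log y := by
  have hN : 1 ≤ ⌊y⌋₊ := Nat.one_le_floor_iff y |>.2 hy
  have hN0 : (1 : ℝ) ≤ ⌊y⌋₊ := by exact_mod_cast hN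
  have hNy : (⌊y⌋₊ : ℝ) ≤ y := Nat.floor_le (by linarith)
  obtain ⟨h1, h2⟩ := sum_one_div_mul_log_div_bounds hN hNy
  have h3 : 0 ≤ log (y / ⌊y⌋₊) := log_nonneg (by rw [le_div_iff₀ (by linarith)]; linarith)
  have h4 : log (y / ⌊y⌋₊) ≤ 1 := by
    have : y / ⌊y⌋₊ ≤ 2 := by
      rw [div_le_iff₀ (by linarith)]
      linarith [Nat.lt_floor_add_one y]
    linarith [log_le_sub_one_of_pos (x := y / ⌊y⌋₊) (by positivity)]
  have h5 : 0 ≤ log (y / ⌊y⌋₊) / ⌊y⌋₊ := by positivity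
  have h6 : 0 ≤ log y := log_nonneg hy
  rw [abs_le]
  constructor <;> nlinarith

/-- The number of triples of positive integers with product at most `y` is
`y (log y)² / 2 + O(y (1 + log y))`. -/
theorem abs_card_triplesLe_floor_sub_le {y : ℝ} (hy : 1 ≤ y) :
    |(#(triplesLe ⌊y⌋₊) : ℝ) - y * log y ^ 2 / 2| ≤ 2 * y * (1 + log y) := by
  have hy0 : 0 ≤ y := by linarith
  have h1 : |(#(triplesLe ⌊y⌋₊) : ℝ) - y * ∑ a ∈ Icc 1 ⌊y⌋₊, 1 / (a : ℝ) * log (y / a)|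
      ≤ y * (1 + log y) := by
    rw [card_triplesLe, Nat.cast_sum, mul_sum, ← sum_sub_distrib]
    refine (abs_sum_le_sum_abs _ _).trans ?_
    have hterm : ∀ a ∈ Icc 1 ⌊y⌋₊,
        |((∑ b ∈ Icc 1 (⌊y⌋₊ / a), ⌊y⌋₊ / a / b : ℕ) : ℝ) - y * (1 / (a : ℝ) * log (y / a))|
          ≤ y * (1 / a) := by
      intro a ha
      rw [mem_Icc] at ha
      have ha0 : (0 : ℝ) < a := by exact_mod_cast ha.1
      have hay : (a : ℝ) ≤ y := (Nat.le_floor_iff hy0).1 ha.2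
      have := abs_sum_floor_div_sub_mul_log_le (z := y / a) (by rwa [le_div_iff₀ ha0, one_mul])
      rw [Nat.floor_div_natCast] at this
      rwa [← mul_assoc, mul_one_div]
    refine (sum_le_sum hterm).trans ?_
    rw [← mul_sum, ← harmonic_eq_sum_one_div]
    exact mul_le_mul_of_nonneg_left (harmonic_floor_le_one_add_log y hy) hy0
  have h2 := mul_le_mul_of_nonneg_left (abs_sum_one_div_mul_log_div_sub_le hy) hy0
  rw [← abs_of_nonneg hy0, ← abs_mul, abs_of_nonneg hy0] at h2
  rw [abs_le] at h1 h2 ⊢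
  constructor <;> linarith [h1.1, h1.2, h2.1, h2.2]

/-- A uniform version of the count of triples with product at most `x / q³`. -/
theorem abs_card_triplesLe_floor_div_cube_sub_le {x : ℝ} (hx : 1 ≤ log x) {q : ℕ} (hq : 1 ≤ q)
    (hx0 : 0 < x) :
    |(#(triplesLe (⌊x⌋₊ / q ^ 3)) : ℝ) - x * log x ^ 2 / 2 * (1 / (q : ℝ) ^ 3)|
      ≤ 4 * (x * log x) * (1 / (q : ℝ) ^ 2) := by
  have hq0 : (1 : ℝ) ≤ q := by exact_mod_cast hq
  have hlq : Real.log q ≤ q - 1 := log_le_sub_one_of_pos (by linarith)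
  have hlq0 : 0 ≤ log (q : ℝ) := log_nonneg hq0
  have hfloor : ⌊x⌋₊ / q ^ 3 = ⌊x / (q : ℝ) ^ 3⌋₊ := by
    rw [← Nat.floor_div_natCast]; push_cast; rfl
  rw [hfloor]
  have hlog : log (x / (q : ℝ) ^ 3) = log x - 3 * Real.log q := by
    rw [log_div hx0.ne' (by positivity), log_pow]; norm_num
  have hy0 : 0 < x / (q : ℝ) ^ 3 := by positivity
  have hmain : x * log x ^ 2 / 2 * (1 / (q : ℝ) ^ 3) = x / (q : ℝ) ^ 3 * log x ^ 2 / 2 := by ring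
  have herr : 4 * (x * log x) * (1 / (q : ℝ) ^ 2) = 4 * (x / (q : ℝ) ^ 3) * log x * q := by
    field_simp
  rw [hmain, herr]
  set y := x / (q : ℝ) ^ 3
  set L := log x
  set l := log (q : ℝ)
  have hyL : 0 < y * L := by positivity
  have hle : 4 * y * L * (1 + l) ≤ 4 * y * L * q :=
    mul_le_mul_of_nonneg_left (by linarith) (by positivity)
  refine le_trans ?_ hle
  rcases le_or_gt 1 y with hy | hy
  · have hly : 0 ≤ log y := log_nonneg hy
    have h := abs_card_triplesLe_floor_sub_le hy
    rw [hlog] at h hly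
    have h1 : 0 ≤ y * (l * L) := by positivity
    have h2 : 0 ≤ y * (l * (L - 3 * l)) := by positivity
    have h3 : 0 ≤ y * (L - 1) := mul_nonneg hy0.le (by linarith)
    have h4 : 0 ≤ y * l := by positivity
    rw [abs_le] at h ⊢
    constructor <;> nlinarith [h.1, h.2]
  · have hly : L - 3 * l ≤ 0 := hlog ▸ log_nonpos hy0.le hy.le
    rw [Nat.floor_eq_zero.2 hy]
    have h0 : #(triplesLe 0) = 0 := by simp [card_triplesLe]
    rw [h0, Nat.cast_zero, zero_sub, abs_neg, abs_of_nonneg (by positivity)]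
    nlinarith [mul_nonneg hyL.le (by linarith : 0 ≤ 3 * l - L), mul_nonneg hyL.le hlq0]

theorem tsum_primes_one_div_cube_sub_one :
    ∑' p : {p : ℕ // p.Prime}, 1 / ((p : ℝ) ^ 3 - 1)
      = ∑' q : {q : ℕ // IsPrimePow q}, 1 / (q : ℝ) ^ 3 := by
  have hs : Summable fun q : {q : ℕ // IsPrimePow q} => 1 / ((q : ℕ) : ℝ) ^ 3 :=
    (summable_one_div_nat_pow.2 (by norm_num : 1 < 3)).subtype _
  rw [← Nat.Primes.prodNatEquiv.tsum_eq]
  have hs' := (Nat.Primes.prodNatEquiv.summable_iff).2 hs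
  refine Eq.trans ?_ (hs'.tsum_prod).symm
  refine tsum_congr fun p : Nat.Primes => ?_
  have hp : (1 : ℝ) < (p : ℕ) := by exact_mod_cast p.2.one_lt
  have hp3 : (1 : ℝ) < ((p : ℕ) : ℝ) ^ 3 := one_lt_pow₀ hp (by norm_num)
  have hgeom := tsum_geometric_of_lt_one (r := 1 / ((p : ℕ) : ℝ) ^ 3) (by positivity)
    (by rw [div_lt_one (by positivity)]; exact hp3)
  have hterm : ∀ k : ℕ, 1 / ((Nat.Primes.prodNatEquiv (p, k) : ℕ) : ℝ) ^ 3
      = 1 / ((p : ℕ) : ℝ) ^ 3 * (1 / ((p : ℕ) : ℝ) ^ 3) ^ k := by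
    intro k
    rw [show (Nat.Primes.prodNatEquiv (p, k) : ℕ) = (p : ℕ) ^ (k + 1) from rfl]
    push_cast
    rw [← pow_succ', div_pow, one_pow, ← pow_mul, ← pow_mul, mul_comm]
  simp only [Function.comp_apply, hterm]
  rw [tsum_mul_left, hgeom]
  have : ((p : ℕ) : ℝ) ^ 3 - 1 ≠ 0 := by linarith
  field_simp

theorem hasSum_card_triplesLe_div_cube (N : ℕ) :
    HasSum (fun q : {q : ℕ // IsPrimePow q} => (#(triplesLe (N / (q : ℕ) ^ 3)) : ℝ))
      (∑ t ∈ triplesLe N, (cardFactors (Nat.gcd t.1 (Nat.gcd t.2.1 t.2.2)) : ℝ)) := by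
  have h : (∑ t ∈ triplesLe N, (cardFactors (Nat.gcd t.1 (Nat.gcd t.2.1 t.2.2)) : ℝ))
      = ∑ q ∈ Icc 1 N, Set.indicator {q : ℕ | IsPrimePow q}
        (fun q => (#(triplesLe (N / q ^ 3)) : ℝ)) q := by
    rw [← Nat.cast_sum, sum_cardFactors_gcd_triplesLe, Nat.cast_sum, sum_filter]
    simp only [Set.indicator_apply, Set.mem_ofPred_eq]
  rw [h]
  refine (hasSum_subtype_iff_indicator (s := {q : ℕ | IsPrimePow q})
    (f := fun q => (#(triplesLe (N / q ^ 3)) : ℝ))).2 (hasSum_sum_of_ne_finset_zero fun q hq => ?_)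
  rw [Set.indicator_apply_eq_zero]
  intro hpp
  have hpos := hpp.pos
  rw [mem_Icc] at hq
  have hlt : N < q ^ 3 := (by omega : N < q).trans_le (Nat.le_self_pow (by norm_num) q)
  simp [Nat.div_eq_of_lt hlt, card_triplesLe]

theorem bigOmega_gcd_hyperbolic_asymptotic :
    (fun x : ℝ =>
        (∑ t ∈ triplesLe ⌊x⌋₊, (cardFactors (Nat.gcd t.1 (Nat.gcd t.2.1 t.2.2)) : ℝ))
          - (∑' p : {p : ℕ // p.Prime}, 1 / ((p : ℝ) ^ 3 - 1)) / 2
              * x * (Real.log x) ^ 2)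
      =O[atTop] fun x : ℝ => x * Real.log x := by
  refine Asymptotics.IsBigO.of_bound
    (4 * ∑' q : {q : ℕ // IsPrimePow q}, 1 / ((q : ℕ) : ℝ) ^ 2) ?_
  filter_upwards [eventually_gt_atTop 0, tendsto_log_atTop.eventually_ge_atTop 1] with x hx0 hx
  have hs2 : Summable fun q : {q : ℕ // IsPrimePow q} => 1 / ((q : ℕ) : ℝ) ^ 2 :=
    (summable_one_div_nat_pow.2 (by norm_num : 1 < 2)).subtype _
  have hs3 : Summable fun q : {q : ℕ // IsPrimePow q} => 1 / ((q : ℕ) : ℝ) ^ 3 :=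
    (summable_one_div_nat_pow.2 (by norm_num : 1 < 3)).subtype _
  have hsum := (hasSum_card_triplesLe_div_cube ⌊x⌋₊).sub
    (hs3.hasSum.mul_left (x * log x ^ 2 / 2))
  rw [← tsum_primes_one_div_cube_sub_one] at hsum
  have hbound := tsum_of_norm_bounded (hs2.hasSum.mul_left (4 * (x * log x)))
    fun q => (Real.norm_eq_abs _).trans_le <| abs_card_triplesLe_floor_div_cube_sub_le hx q.2.pos hx0
  rw [hsum.tsum_eq] at hbound
  rw [Real.norm_of_nonneg (by positivity : 0 ≤ x * log x)]
  convert hbound using 1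
  · congr 1
    ring
  · ring
end

section
/- For all integers k ≥ 2 and r ≥ 2, one has ∑_{m=1}^{r} (-1)^{m-1}·binomial(r,m)·∑_{n₁n₂⋯n_r = k} ω(gcd(n₁,n₂,…,n_m)) = ω(k)·τ_r(k), where the inner sums are over all r-tuples of positive integers with product equal to k, and gcd(n₁,…,n_m) is the greatest common divisor of the first m coordinates. -/
open Finset ArithmeticFunction

/-- The set of `r`-tuples of positive integers whose product equals `k`. -/
noncomputable def tuplesEq (r k : ℕ) : Finset (Fin r → ℕ) :=
  (Fintype.piFinset fun _ : Fin r => k.divisors).filter fun t => ∏ i, t i = k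

/-- The `r`-fold divisor function `τ_r(k)`: the number of `r`-tuples of positive
integers with product `k`. -/
noncomputable def tauR (r k : ℕ) : ℕ := (tuplesEq r k).card

lemma cardDistinctFactors_eq_card_primeFactors (n : ℕ) :
    cardDistinctFactors n = n.primeFactors.card := by
  rw [cardDistinctFactors_apply, ← List.card_toFinset]; rfl

lemma mem_tuplesEq {r k : ℕ} (hk : k ≠ 0) {t : Fin r → ℕ} :
    t ∈ tuplesEq r k ↔ ∏ i, t i = k := by
  simp only [tuplesEq, mem_filter, Fintype.mem_piFinset, Nat.mem_divisors, and_iff_right_iff_imp]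
  rintro rfl i
  exact ⟨dvd_prod_of_mem t (mem_univ i), hk⟩

/-- Sums over `tuplesEq r k` of a function of the gcd over a set of coordinates depend only on the
number of coordinates. -/
lemma sum_tuplesEq_gcd_eq_of_card_eq {M : Type*} [AddCommMonoid M] {r k : ℕ} (hk : k ≠ 0)
    (f : ℕ → M) {S T : Finset (Fin r)} (h : #S = #T) :
    ∑ t ∈ tuplesEq r k, f (S.gcd t) = ∑ t ∈ tuplesEq r k, f (T.gcd t) := by
  let e : {x // x ∈ T} ≃ {x // x ∈ S} := Finset.equivOfCardEq h.symm
  let σ : Equiv.Perm (Fin r) := e.extendSubtype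
  have hS : T.image σ = S := by
    refine eq_of_subset_of_card_le (fun x hx => ?_) ?_
    · obtain ⟨y, hy, rfl⟩ := mem_image.1 hx
      exact e.extendSubtype_mem y hy
    · rw [card_image_of_injective _ σ.injective, h]
  refine sum_equiv (σ.symm.arrowCongr (Equiv.refl ℕ)) (fun t => ?_) fun t _ => ?_
  · rw [mem_tuplesEq hk, mem_tuplesEq hk]
    simp [Equiv.arrowCongr, Equiv.prod_comp σ t]
  · rw [← hS, gcd_image]
    rfl

/-- Inclusion-exclusion for the number of distinct prime factors of a product. -/
lemma sum_powerset_cardDistinctFactors_gcd {ι : Type*} [DecidableEq ι] (s : Finset ι) (t : ι → ℕ)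
    (ht : ∀ i ∈ s, t i ≠ 0) :
    ∑ S ∈ s.powerset, (-1 : ℤ) ^ (#S + 1) * (cardDistinctFactors (S.gcd t) : ℤ)
      = cardDistinctFactors (∏ i ∈ s, t i) := by
  have hprod : (∏ i ∈ s, t i).primeFactors = s.biUnion fun i => (t i).primeFactors := by
    ext p
    simp only [Nat.mem_primeFactors, mem_biUnion, prod_ne_zero_iff]
    constructor
    · rintro ⟨hp, hd, -⟩
      obtain ⟨i, hi, hpi⟩ := (hp.prime.dvd_finsetProd_iff t).1 hd
      exact ⟨i, hi, hp, hpi, ht i hi⟩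
    · rintro ⟨i, hi, hp, hpi, -⟩
      exact ⟨hp, hpi.trans (dvd_prod_of_mem t hi), ht⟩
  rw [cardDistinctFactors_eq_card_primeFactors, hprod, inclusion_exclusion_card_biUnion,
    ← sum_filter_of_ne (p := fun S : Finset ι => S.Nonempty), ← sum_coe_sort]
  · refine sum_congr rfl fun ⟨S, hS⟩ _ => ?_
    obtain ⟨hSs, hne⟩ := mem_filter.1 hS
    rw [cardDistinctFactors_eq_card_primeFactors]
    congr 3
    ext p
    obtain ⟨j, hj⟩ := hne
    have hts : ∀ i ∈ S, t i ≠ 0 := fun i hi => ht i (mem_powerset.1 hSs hi)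
    simp only [Nat.mem_primeFactors, mem_inf', Finset.dvd_gcd_iff, ne_eq, Finset.gcd_eq_zero_iff]
    exact ⟨fun h i hi => ⟨h.1, h.2.1 i hi, hts i hi⟩,
      fun h => ⟨(h j hj).1, fun i hi => (h i hi).2.1, fun h0 => hts j hj (h0 j hj)⟩⟩
  · intro S _ hS
    rw [nonempty_iff_ne_empty]
    rintro rfl
    simp at hS

theorem alternating_sum_omega_gcd_eq_omega_mul_tauR (k r : ℕ) (hk : 2 ≤ k) (hr : 2 ≤ r) :
    ∑ m ∈ Finset.Icc 1 r, (-1 : ℤ) ^ (m - 1) * (r.choose m : ℤ) *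
        ∑ t ∈ tuplesEq r k,
          (cardDistinctFactors ((Finset.univ.filter fun i : Fin r => (i : ℕ) < m).gcd t) : ℤ)
      = (cardDistinctFactors k : ℤ) * (tauR r k : ℤ) := by
  have hk0 : k ≠ 0 := by omega
  let G : ℕ → ℤ := fun m => ∑ t ∈ tuplesEq r k,
    (cardDistinctFactors ((univ.filter fun i : Fin r => (i : ℕ) < m).gcd t) : ℤ)
  have hG (S : Finset (Fin r)) :
      ∑ t ∈ tuplesEq r k, (cardDistinctFactors (S.gcd t) : ℤ) = G #S := by
    refine sum_tuplesEq_gcd_eq_of_card_eq hk0 (fun n => (cardDistinctFactors n : ℤ)) ?_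
    have hS : #S ≤ r := by simpa using card_le_univ S
    rw [Fin.card_filter_val_lt, min_eq_right hS]
  calc
    _ = ∑ m ∈ range (r + 1), r.choose m • ((-1 : ℤ) ^ (m + 1) * G m) := by
      have hG0 : G 0 = 0 := by simp [G]
      refine sum_subset_zero_on_sdiff (fun m hm => ?_) (fun m hm => ?_) fun m hm => ?_
      · simp only [mem_Icc, mem_range] at hm ⊢
        omega
      · obtain rfl : m = 0 := by
          simp only [mem_sdiff, mem_Icc, mem_range] at hm
          omega
        simp [hG0]
      · obtain ⟨n, rfl⟩ := Nat.exists_eq_add_of_le' (mem_Icc.1 hm).1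
        rw [nsmul_eq_mul, Nat.add_sub_cancel, pow_add _ (n + 1), pow_succ]
        simp only [G]
        ring
    _ = ∑ S ∈ (univ : Finset (Fin r)).powerset, (-1 : ℤ) ^ (#S + 1) * G #S := by
      rw [sum_powerset_apply_card (fun m => (-1 : ℤ) ^ (m + 1) * G m), card_univ, Fintype.card_fin]
    _ = ∑ t ∈ tuplesEq r k, ∑ S ∈ (univ : Finset (Fin r)).powerset,
          (-1 : ℤ) ^ (#S + 1) * (cardDistinctFactors (S.gcd t) : ℤ) := by
      rw [sum_comm]
      simp_rw [← hG, mul_sum]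
    _ = ∑ t ∈ tuplesEq r k, (cardDistinctFactors k : ℤ) := by
      refine sum_congr rfl fun t ht => ?_
      have htk := (mem_tuplesEq hk0).1 ht
      rw [sum_powerset_cardDistinctFactors_gcd, htk]
      exact prod_ne_zero_iff.1 (htk ▸ hk0)
    _ = _ := by
      rw [sum_const, nsmul_eq_mul, mul_comm, tauR]
end

section
/- For every positive integer n, ∑_{abc = n} Ω(gcd(a,b,c)) = ∑_{d³m = n} (μ ∗ Ω)(d)·τ₃(m), where the left sum is over triples (a,b,c) of positive integers with abc = n and the right sum is over pairs (d,m) of positive integers with d³·m = n. -/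
open Finset ArithmeticFunction

/-- The set of triples of positive integers whose product equals `n`. -/
noncomputable def triplesEq (n : ℕ) : Finset (ℕ × ℕ × ℕ) :=
  (n.divisors ×ˢ n.divisors ×ˢ n.divisors).filter fun t => t.1 * t.2.1 * t.2.2 = n

/-- `τ₃(n)`: the number of triples of positive integers with product `n`. -/
noncomputable def tau3 (n : ℕ) : ℕ := (triplesEq n).card

/-- The Dirichlet convolution `(μ ∗ Ω)(n) = ∑_{d ∣ n} μ(d) Ω(n/d)`. -/
noncomputable def muConvOmega (n : ℕ) : ℤ :=
  ∑ d ∈ n.divisors, moebius d * (cardFactors (n / d) : ℤ)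

theorem sum_divisors_muConvOmega {n : ℕ} (hn : 0 < n) :
    ∑ d ∈ n.divisors, muConvOmega d = (cardFactors n : ℤ) := by
  refine (sum_eq_iff_sum_mul_moebius_eq (f := muConvOmega)
    (g := fun n => (cardFactors n : ℤ))).2 (fun m _ => ?_) n hn
  simpa [muConvOmega] using
    Nat.sum_divisorsAntidiagonal (fun a b => moebius a * (cardFactors b : ℤ)) (n := m)

theorem mem_triplesEq {n : ℕ} (hn : n ≠ 0) {t : ℕ × ℕ × ℕ} :
    t ∈ triplesEq n ↔ t.1 * t.2.1 * t.2.2 = n := by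
  simp only [triplesEq, mem_filter, mem_product, Nat.mem_divisors, and_iff_right_iff_imp]
  rintro rfl
  exact ⟨⟨⟨_, mul_assoc _ _ _⟩, hn⟩, ⟨⟨t.1 * t.2.2, by ring⟩, hn⟩, Dvd.intro_left _ rfl, hn⟩

theorem sum_bigOmega_gcd_eq_conv (n : ℕ) (hn : 0 < n) :
    ∑ t ∈ triplesEq n, (cardFactors (Nat.gcd t.1 (Nat.gcd t.2.1 t.2.2)) : ℤ)
      = ∑ q ∈ (n.divisors ×ˢ n.divisors).filter (fun q => q.1 ^ 3 * q.2 = n),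
          muConvOmega q.1 * (tau3 q.2 : ℤ) := by
  have expand_left : ∀ t ∈ triplesEq n,
      (cardFactors (Nat.gcd t.1 (Nat.gcd t.2.1 t.2.2)) : ℤ)
        = ∑ d ∈ (Nat.gcd t.1 (Nat.gcd t.2.1 t.2.2)).divisors, muConvOmega d := by
    intro t ht
    rw [mem_triplesEq hn.ne'] at ht
    refine (sum_divisors_muConvOmega (Nat.gcd_pos_of_pos_left _ (Nat.pos_of_ne_zero ?_))).symm
    intro h
    simp [h] at ht
    omega
  have expand_right : ∀ q : ℕ × ℕ,
      muConvOmega q.1 * (tau3 q.2 : ℤ) = ∑ _t ∈ triplesEq q.2, muConvOmega q.1 := by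
    intro q
    rw [sum_const, nsmul_eq_mul, mul_comm, tau3]
  rw [sum_congr rfl expand_left, sum_congr rfl fun q _ => expand_right q, sum_sigma', sum_sigma']
  have cube_mul {a b c d : ℕ} : d * a * (d * b) * (d * c) = d ^ 3 * (a * b * c) := by ring
  symm
  refine sum_bij (fun x _ => ⟨(x.1.1 * x.2.1, x.1.1 * x.2.2.1, x.1.1 * x.2.2.2), x.1.1⟩)
    ?_ ?_ ?_ (fun _ _ => rfl)
  · rintro ⟨⟨d, m⟩, a, b, c⟩ hx
    simp only [mem_sigma, mem_filter, mem_product, Nat.mem_divisors] at hx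
    obtain ⟨⟨-, h⟩, ht⟩ := hx
    have hm0 : m ≠ 0 := by
      rintro rfl
      omega
    rw [mem_triplesEq hm0] at ht
    have hd : d * a * (d * b) * (d * c) = n := by rw [cube_mul, ht, h]
    simp only [mem_sigma, mem_triplesEq hn.ne', Nat.mem_divisors]
    refine ⟨hd, by simp [Nat.gcd_mul_left], ?_⟩
    intro h0
    rw [Nat.gcd_eq_zero_iff] at h0
    simp [h0.1] at hd
    omega
  · rintro ⟨⟨d, m⟩, a, b, c⟩ hx ⟨⟨d', m'⟩, a', b', c'⟩ hx' heq
    simp only [mem_sigma, mem_filter, mem_product, Nat.mem_divisors] at hx hx'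
    simp only [Sigma.mk.injEq, Prod.mk.injEq, heq_eq_eq] at heq
    obtain ⟨⟨ha, hb, hc⟩, rfl⟩ := heq
    have hd : 0 < d := Nat.pos_of_dvd_of_pos hx.1.1.1.1 hn
    obtain rfl := Nat.eq_of_mul_eq_mul_left hd ha
    obtain rfl := Nat.eq_of_mul_eq_mul_left hd hb
    obtain rfl := Nat.eq_of_mul_eq_mul_left hd hc
    obtain rfl := Nat.eq_of_mul_eq_mul_left (pow_pos hd 3) (hx.1.2.trans hx'.1.2.symm)
    rfl
  · rintro ⟨⟨a, b, c⟩, d⟩ hx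
    simp only [mem_sigma, mem_triplesEq hn.ne', Nat.mem_divisors, Nat.dvd_gcd_iff] at hx
    obtain ⟨h, ⟨⟨a, rfl⟩, ⟨b, rfl⟩, ⟨c, rfl⟩⟩, -⟩ := hx
    rw [cube_mul] at h
    have hm0 : a * b * c ≠ 0 := by
      intro h0
      simp [h0] at h
      omega
    refine ⟨⟨(d, a * b * c), a, b, c⟩, ?_, rfl⟩
    simp only [mem_sigma, mem_filter, mem_product, Nat.mem_divisors, mem_triplesEq hm0, h,
      and_true]
    exact ⟨⟨(dvd_pow_self d three_ne_zero).trans ⟨_, h.symm⟩, hn.ne'⟩,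
      ⟨_, h.symm.trans (mul_comm _ _)⟩, hn.ne'⟩
end
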